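/- arXiv:2007.11872 — 4 statements merged into one kernel-verified Lean document; each statement's English description precedes it below -/
import Mathlib

section
/- Let V be a ℚ-vector space, β : V × V → ℚ a symmetric bilinear form, and write q(v) = β(v,v) for the associated quadratic form. Let A be a commutative ring which is also a ℚ-algebra, let ι : V → A be a ℚ-linear map, and let n ≥ 0 be an integer. Assume that ι(v)^(n+1) = 0 for every v ∈ V with q(v) = 0. Then for all x, s ∈ V with q(x) = 0, q(s) = 0 and β(x,s) = 0, one has ι(x)^n · ι(s) = 0 in A. -/
open Polynomial in
/-- A polynomial over an algebra `A` over an infinite field `K` is zero as soon as it vanishes at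
all scalars from `K`. -/
theorem Polynomial.eq_zero_of_forall_eval_algebraMap_eq_zero {K A : Type*} [Field K] [Infinite K]
    [CommRing A] [Algebra K A] (p : A[X]) (h : ∀ t : K, p.eval (algebraMap K A t) = 0) :
    p = 0 := by
  ext i
  rw [coeff_zero, ← Module.forall_dual_apply_eq_zero_iff K]
  intro f
  set r : K[X] := ∑ j ∈ Finset.range (p.natDegree + 1), C (f (p.coeff j)) * X ^ j with hr
  have hr_zero : r = 0 := by
    refine Polynomial.funext fun t => ?_
    have ht := congrArg f (h t)
    have hsmul (j : ℕ) : p.coeff j * algebraMap K A t ^ j = t ^ j • p.coeff j := by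
      rw [Algebra.smul_def, map_pow, mul_comm]
    simp only [eval_eq_sum_range, hsmul, map_sum, map_smul, map_zero, smul_eq_mul] at ht
    simpa only [hr, eval_finsetSum, eval_mul, eval_C, eval_pow, eval_X, eval_zero,
      mul_comm (f _)] using ht
  by_cases hi : p.natDegree < i
  · rw [coeff_eq_zero_of_natDegree_lt hi, map_zero]
  · have hc := congrArg (fun u : K[X] => u.coeff i) hr_zero
    simp only [hr, finsetSum_coeff, coeff_C_mul_X_pow, coeff_zero, Finset.sum_ite_eq,
      Finset.mem_range] at hc
    rwa [if_pos (by omega)] at hc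

open Polynomial in
/-- If `(a + t b) ^ (n + 1) = 0` for all rational `t`, then the linear coefficient in `t`
gives `a ^ n * b = 0`. -/
theorem pow_mul_eq_zero_of_forall_add_smul_pow_eq_zero {A : Type*} [CommRing A] [Algebra ℚ A]
    {a b : A} {n : ℕ} (h : ∀ t : ℚ, (a + t • b) ^ (n + 1) = 0) : a ^ n * b = 0 := by
  have hp : (C a + C b * X) ^ (n + 1) = 0 :=
    eq_zero_of_forall_eval_algebraMap_eq_zero (K := ℚ) _ fun t => by
      simpa [Algebra.smul_def, mul_comm b] using h t
  have hd := congrArg (fun u : A[X] => u.derivative.eval 0) hp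
  have hn : ((n + 1 : ℕ) : ℚ) • (a ^ n * b) = 0 := by
    simpa [derivative_pow, Algebra.smul_def, mul_assoc] using hd
  exact (smul_eq_zero.mp hn).resolve_left (Nat.cast_ne_zero.mpr n.succ_ne_zero)

/-- Differentiated Beauville–Fujiki relation: if `ι v ^ (n+1) = 0` for every
isotropic `v`, then `ι x ^ n * ι s = 0` whenever `x`, `s` are isotropic and
orthogonal to each other. -/
theorem stmt_0 (V : Type*) [AddCommGroup V] [Module ℚ V]
    (β : V →ₗ[ℚ] V →ₗ[ℚ] ℚ) (hβ : ∀ v w : V, β v w = β w v)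
    (A : Type*) [CommRing A] [Algebra ℚ A]
    (ι : V →ₗ[ℚ] A) (n : ℕ)
    (hfujiki : ∀ v : V, β v v = 0 → ι v ^ (n + 1) = 0)
    (x s : V) (hx : β x x = 0) (hs : β s s = 0) (hxs : β x s = 0) :
    ι x ^ n * ι s = 0 := by
  refine pow_mul_eq_zero_of_forall_add_smul_pow_eq_zero fun t => ?_
  rw [← map_smul, ← map_add]
  exact hfujiki _ (by simp [hx, hs, hxs, hβ s x])
end

section
/- Let A be a commutative ring which is also a ℚ-algebra. For u ∈ A with 1 − u nilpotent, u is invertible; define log u = −Σ_{k ≥ 1} (1−u)^k/k, a finite sum since 1 − u is nilpotent, and note log u is nilpotent. Let u, w ∈ A be two elements with 1 − u and 1 − w nilpotent, and suppose that (log u)^(2r) = (log w)^(2r) for every integer r ≥ 1. Then u + u^(−1) = w + w^(−1). -/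
/-- The logarithm of a unipotent element `u` (so `1 - u` nilpotent, with
`(1-u)^k = 0` for `k > N`): `log u = -∑_{k=1}^{N} (1-u)^k / k`, a finite sum. -/
def nilLog {A : Type*} [CommRing A] [Algebra ℚ A] (u : A) (N : ℕ) : A :=
  -∑ k ∈ Finset.Icc 1 N, ((k : ℚ)⁻¹) • (1 - u) ^ k

theorem map_nilLog {A B : Type*} [CommRing A] [Algebra ℚ A] [CommRing B] [Algebra ℚ B]
    (f : A →+* B) (u : A) (N : ℕ) : f (nilLog u N) = nilLog (f u) N := by
  simp [nilLog, map_rat_smul]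

theorem isNilpotent_nilLog {A : Type*} [CommRing A] [Algebra ℚ A] {u : A}
    (hu : IsNilpotent (1 - u)) (N : ℕ) : IsNilpotent (nilLog u N) := by
  rw [← mem_nilradical] at hu ⊢
  refine neg_mem (sum_mem fun k hk => ?_)
  rw [Algebra.smul_def]
  exact Ideal.mul_mem_left _ _ (Ideal.pow_mem_of_mem _ hu _ (Finset.mem_Icc.1 hk).1)

theorem IsNilpotent.derivation_exp {B : Type*} [CommRing B] [Algebra ℚ B]
    (D : Derivation ℚ B B) {a : B} (ha : IsNilpotent a) :
    D (IsNilpotent.exp a) = IsNilpotent.exp a * D a := by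
  obtain ⟨k, hk⟩ := ha
  conv_lhs => rw [IsNilpotent.exp_eq_sum (pow_eq_zero_of_le k.le_succ hk), Finset.sum_range_succ']
  rw [IsNilpotent.exp_eq_sum hk]
  simp only [map_add, map_sum, D.map_smul, Derivation.leibniz_pow, Finset.sum_mul]
  simp only [Nat.factorial_zero, smul_zero, add_zero,
    zero_nsmul]
  refine Finset.sum_congr rfl fun i _ => ?_
  rw [← Nat.cast_smul_eq_nsmul ℚ, smul_smul, Nat.add_sub_cancel, smul_eq_mul, smul_mul_assoc]
  congr 1
  rw [Nat.factorial_succ]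
  push_cast
  field_simp

/-- The logarithmic derivative of a unipotent element, multiplied out. -/
theorem mul_derivation_nilLog {B : Type*} [CommRing B] [Algebra ℚ B]
    (D : Derivation ℚ B B) {v : B} {N : ℕ} (hv : (1 - v) ^ N = 0) :
    v * D (nilLog v N) = D v := by
  have h : D (nilLog v N) = (∑ i ∈ Finset.range N, (1 - v) ^ i) * D v := by
    rw [nilLog, ← Finset.Ico_add_one_right_eq_Icc, Finset.sum_Ico_eq_sum_range,
      Nat.add_sub_cancel, map_neg, map_sum, Finset.sum_mul, ← Finset.sum_neg_distrib]
    refine Finset.sum_congr rfl fun i _ => ?_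
    have hi : ((1 + i : ℕ) : ℚ) ≠ 0 := Nat.cast_ne_zero.2 (by omega)
    rw [D.map_smul, Derivation.leibniz_pow, ← Nat.cast_smul_eq_nsmul ℚ, smul_smul,
      inv_mul_cancel₀ hi, one_smul, Nat.add_sub_cancel_left, map_sub,
      Derivation.map_one_eq_zero, zero_sub, smul_neg, neg_neg, smul_eq_mul]
  have hgeom := mul_neg_geom_sum (1 - v) N
  rw [hv, sub_sub_cancel, sub_zero] at hgeom
  rw [h, ← mul_assoc, hgeom, one_mul]

open Polynomial in
/-- The proof deforms `u` to `1` along the polynomial path `1 - (1 - u) X`. -/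
theorem exp_neg_nilLog_mul {A : Type*} [CommRing A] [Algebra ℚ A] {u : A} {N : ℕ}
    (hu : (1 - u) ^ N = 0) : IsNilpotent.exp (-nilLog u N) * u = 1 := by
  have : IsAddTorsionFree A := .of_module_rat A
  set v : A[X] := 1 - C (1 - u) * X with hvdef
  have hv : (1 - v) ^ N = 0 := by
    rw [hvdef, sub_sub_cancel, mul_pow, ← C_pow, hu, C_0, zero_mul]
  have hL : IsNilpotent (-nilLog v N) := (isNilpotent_nilLog ⟨N, hv⟩ N).neg
  let D : Derivation ℚ A[X] A[X] := (derivative' (R := A)).restrictScalars ℚ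
  have hD : derivative (IsNilpotent.exp (-nilLog v N) * v) = 0 := by
    change D _ = 0
    rw [Derivation.leibniz, IsNilpotent.derivation_exp D hL, map_neg, smul_eq_mul, smul_eq_mul,
      ← mul_derivation_nilLog D hv]
    ring
  have heval (t : A) : (IsNilpotent.exp (-nilLog v N) * v).eval t =
      IsNilpotent.exp (-nilLog (1 - (1 - u) * t) N) * (1 - (1 - u) * t) := by
    have hvt : v.eval t = 1 - (1 - u) * t := by simp [hvdef]
    rw [eval_mul, ← coe_evalRingHom, IsNilpotent.map_exp hL, map_neg, map_nilLog,
      coe_evalRingHom, hvt]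
  have hconst := eq_C_of_derivative_eq_zero hD
  have h0 := heval 0
  have h1 := heval 1
  rw [hconst, eval_C] at h0 h1
  rw [h0] at h1
  have hlog1 : nilLog (1 : A) N = 0 := by
    refine neg_eq_zero.2 (Finset.sum_eq_zero fun k hk => ?_)
    rw [sub_self, zero_pow (Nat.one_le_iff_ne_zero.1 (Finset.mem_Icc.1 hk).1), smul_zero]
  simpa [hlog1] using h1.symm

theorem add_inverse_eq_exp_nilLog {A : Type*} [CommRing A] [Algebra ℚ A] {u : A} {N : ℕ}
    (hu : (1 - u) ^ N = 0) :
    u + Ring.inverse u = IsNilpotent.exp (nilLog u N) + IsNilpotent.exp (-nilLog u N) := by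
  have hL := isNilpotent_nilLog ⟨N, hu⟩ N
  have h := exp_neg_nilLog_mul hu
  have hexp : u = IsNilpotent.exp (nilLog u N) :=
    (left_inv_eq_right_inv (IsNilpotent.exp_mul_exp_neg_self hL) h).symm
  have hinv : Ring.inverse u = IsNilpotent.exp (-nilLog u N) :=
    Ring.inverse_unit ⟨u, _, (mul_comm _ _).trans h, h⟩
  rw [hinv, ← hexp]

theorem exp_add_exp_neg_eq_of_even_pow_eq {A : Type*} [CommRing A] [Algebra ℚ A] {a b : A}
    (ha : IsNilpotent a) (hb : IsNilpotent b)
    (h : ∀ r : ℕ, 1 ≤ r → a ^ (2 * r) = b ^ (2 * r)) :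
    IsNilpotent.exp a + IsNilpotent.exp (-a) = IsNilpotent.exp b + IsNilpotent.exp (-b) := by
  obtain ⟨m, hm⟩ := ha
  obtain ⟨n, hn⟩ := hb
  have ham : a ^ (m + n) = 0 := pow_eq_zero_of_le (Nat.le_add_right m n) hm
  have hbn : b ^ (m + n) = 0 := pow_eq_zero_of_le (Nat.le_add_left n m) hn
  have ham' : (-a) ^ (m + n) = 0 := by rw [neg_pow, ham, mul_zero]
  have hbn' : (-b) ^ (m + n) = 0 := by rw [neg_pow, hbn, mul_zero]
  rw [IsNilpotent.exp_eq_sum ham, IsNilpotent.exp_eq_sum hbn, IsNilpotent.exp_eq_sum ham',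
    IsNilpotent.exp_eq_sum hbn', ← Finset.sum_add_distrib, ← Finset.sum_add_distrib]
  refine Finset.sum_congr rfl fun i _ => ?_
  rw [← smul_add, ← smul_add]
  congr 1
  rcases Nat.even_or_odd i with hi | hi
  · rw [hi.neg_pow, hi.neg_pow]
    obtain ⟨r, rfl⟩ := hi.two_dvd
    rcases Nat.eq_zero_or_pos r with rfl | hr
    · simp
    · rw [h r hr]
  · rw [hi.neg_pow, hi.neg_pow, add_neg_cancel, add_neg_cancel]

/-- Computational core of Proposition 4.8: if `u`, `w` are unipotent elements
of a commutative `ℚ`-algebra (hence invertible) and all even powers of their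
logarithms agree, then `u + u⁻¹ = w + w⁻¹`. -/
theorem stmt_7 (A : Type*) [CommRing A] [Algebra ℚ A]
    (u w : A) (N M : ℕ) (hu : (1 - u) ^ N = 0) (hw : (1 - w) ^ M = 0)
    (hlog : ∀ r : ℕ, 1 ≤ r → (nilLog u N) ^ (2 * r) = (nilLog w M) ^ (2 * r)) :
    u + Ring.inverse u = w + Ring.inverse w := by
  rw [add_inverse_eq_exp_nilLog hu, add_inverse_eq_exp_nilLog hw]
  exact exp_add_exp_neg_eq_of_even_pow_eq (isNilpotent_nilLog ⟨N, hu⟩ N)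
    (isNilpotent_nilLog ⟨M, hw⟩ M) hlog
end

section
/- Let A be a commutative ring, let n ≥ 1 be an integer, and let Z : Fin n × Fin n → A be a family of elements such that Z(i,j)·Z(k,j) = 0 for all i, k, j ∈ Fin n (in particular Z(i,j)² = 0). Then (Σ_{(i,j) ∈ Fin n × Fin n} Z(i,j))^n = n! · Σ_{f : Fin n → Fin n} ∏_{j ∈ Fin n} Z(f(j), j). -/
theorem add_pow_succ_of_sq_eq_zero {A : Type*} [CommSemiring A] {a : A} (ha : a ^ 2 = 0)
    (b : A) (m : ℕ) : (a + b) ^ (m + 1) = b ^ (m + 1) + (m + 1) * a * b ^ m := by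
  induction m with
  | zero => simp [add_comm]
  | succ m ih =>
    calc (a + b) ^ (m + 1 + 1)
        = b ^ (m + 1 + 1) + (m + 1 + 1) * a * b ^ (m + 1) + (m + 1) * b ^ m * a ^ 2 := by
          rw [pow_succ, ih]; ring
      _ = _ := by rw [ha]; push_cast; ring

theorem Finset.sum_pow_card_of_sq_eq_zero {ι A : Type*} [CommSemiring A] (s : Finset ι)
    (y : ι → A) (hy : ∀ j ∈ s, y j ^ 2 = 0) :
    (∑ j ∈ s, y j) ^ s.card = (s.card.factorial : A) * ∏ j ∈ s, y j := by
  classical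
  induction s using Finset.induction_on with
  | empty => simp
  | insert a s ha ih =>
    have ih := ih fun j hj => hy j (Finset.mem_insert_of_mem hj)
    have hprod : (∏ j ∈ s, y j) * ∑ j ∈ s, y j = 0 := by
      rw [Finset.mul_sum]
      refine Finset.sum_eq_zero fun j hj => ?_
      rw [← Finset.prod_erase_mul s y hj, mul_assoc, ← sq,
        hy j (Finset.mem_insert_of_mem hj), mul_zero]
    rw [Finset.sum_insert ha, Finset.prod_insert ha, Finset.card_insert_of_notMem ha,
      add_pow_succ_of_sq_eq_zero (hy a (Finset.mem_insert_self a s)), pow_succ, ih, mul_assoc,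
      hprod, Nat.factorial_succ]
    push_cast
    ring

/-- Expansion step in the proof of Proposition 4.11: if `Z(i,j) * Z(k,j) = 0`
for all `i, k, j`, then the `n`-th power of `∑ Z(i,j)` equals `n!` times the
sum over all maps `f : Fin n → Fin n` of `∏_j Z(f j, j)`. -/
theorem stmt_8 (A : Type*) [CommRing A] (n : ℕ) (hn : 1 ≤ n)
    (Z : Fin n × Fin n → A)
    (hZ : ∀ i k j : Fin n, Z (i, j) * Z (k, j) = 0) :
    (∑ p : Fin n × Fin n, Z p) ^ n =
      (n.factorial : A) * ∑ f : Fin n → Fin n, ∏ j : Fin n, Z (f j, j) := by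
  have hsq : ∀ j ∈ Finset.univ, (∑ i, Z (i, j)) ^ 2 = 0 := fun j _ => by
    simp [sq, Finset.sum_mul_sum, hZ]
  have hpow := Finset.sum_pow_card_of_sq_eq_zero Finset.univ (fun j => ∑ i, Z (i, j)) hsq
  rw [Finset.card_univ, Fintype.card_fin] at hpow
  rw [Fintype.sum_prod_type_right, hpow, Fintype.prod_sum]
end

section
/- Let (V_k)_{k ∈ ℕ} be a family of vector spaces over ℚ, and for each k ∈ ℕ let μ_k : V_k → V_{k+1} and γ_k : V_{k+1} → V_k be ℚ-linear maps satisfying γ_0 ∘ μ_0 = id_{V_0} and, for every k ≥ 1, γ_k ∘ μ_k = id_{V_k} + μ_{k−1} ∘ γ_{k−1}. Then μ_k is injective for every k ∈ ℕ. -/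
/-- Every `c + γ k ∘ μ k` with `0 ≤ c` has trivial kernel. -/
theorem eq_zero_of_smul_add_comp_eq_zero (V : ℕ → Type*) [∀ k, AddCommGroup (V k)]
    [∀ k, Module ℚ (V k)]
    (μ : ∀ k, V k →ₗ[ℚ] V (k + 1)) (γ : ∀ k, V (k + 1) →ₗ[ℚ] V k)
    (h0 : (γ 0).comp (μ 0) = LinearMap.id)
    (hrec : ∀ k : ℕ, (γ (k + 1)).comp (μ (k + 1)) =
      LinearMap.id + (μ k).comp (γ k)) (k : ℕ) :
    ∀ (c : ℚ), 0 ≤ c → ∀ y : V k, c • y + γ k (μ k y) = 0 → y = 0 := by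
  induction k with
  | zero =>
    intro c hc y hy
    have h : γ 0 (μ 0 y) = y := LinearMap.congr_fun h0 y
    have hy' : (c + 1) • y = 0 := by rw [add_smul, one_smul]; rwa [h] at hy
    exact (smul_eq_zero.mp hy').resolve_left (by positivity)
  | succ k ih =>
    intro c hc y hy
    have h : γ (k + 1) (μ (k + 1) y) = y + μ k (γ k y) := LinearMap.congr_fun (hrec k) y
    have hy' : (c + 1) • y + μ k (γ k y) = 0 := by
      rw [add_smul, one_smul, add_assoc, ← h, hy]
    have hγ : γ k y = 0 := ih (c + 1) (by positivity) (γ k y) (by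
      simpa only [map_add, map_smul, map_zero] using congrArg (γ k) hy')
    rw [hγ, map_zero, add_zero] at hy'
    exact (smul_eq_zero.mp hy').resolve_left (by positivity)

/-- Abstract mechanism behind Lemma 4.14: given `ℚ`-linear maps
`μ k : V k → V (k+1)` and `γ k : V (k+1) → V k` with `γ 0 ∘ μ 0 = id` and
`γ (k+1) ∘ μ (k+1) = id + μ k ∘ γ k`, every `μ k` is injective. -/
theorem stmt_9 (V : ℕ → Type*) [∀ k, AddCommGroup (V k)] [∀ k, Module ℚ (V k)]
    (μ : ∀ k, V k →ₗ[ℚ] V (k + 1)) (γ : ∀ k, V (k + 1) →ₗ[ℚ] V k)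
    (h0 : (γ 0).comp (μ 0) = LinearMap.id)
    (hrec : ∀ k : ℕ, (γ (k + 1)).comp (μ (k + 1)) =
      LinearMap.id + (μ k).comp (γ k)) :
    ∀ k : ℕ, Function.Injective (μ k) := by
  intro k
  rw [injective_iff_map_eq_zero]
  intro x hx
  exact eq_zero_of_smul_add_comp_eq_zero V μ γ h0 hrec k 0 le_rfl x (by simp [hx])
end
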